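/- Let a be a coefficient family that is τ-invariant and at most 1-singular on W, where W is admissible, with analytic witnesses g_{(m,μ)} (analytic on W, with a_{(m,μ)} = g_{(m,μ)}/z₁ on W ∩ {z₁ ≠ 0}). Let F : ℂ × (Fin d → ℂ) → ℂ be analytic on W with F ∘ τ = F on W. Then the function (a · F)(z₁, z′) = Σ_{(m,μ)} a_{(m,μ)}(z₁, z′) · F(z₁ − m, z′ − μ), defined on {(z₁, z′) ∈ W : z₁ ≠ 0}, extends to a function analytic at v, and the value of this extension at v equals Σ_{(m,μ)} [ g_{(m,μ)}(0, w₀) · ∂₁F(−m, w₀ − μ) + ∂₁g_{(m,μ)}(0, w₀) · (1/2)(F(−m, w₀ − μ) + F(m, w₀ − μ)) ], where ∂₁F(−m, w₀ − μ) denotes the derivative at −m of t ↦ F(t, w₀ − μ) and ∂₁g_{(m,μ)}(0, w₀) denotes the derivative at 0 of t ↦ g_{(m,μ)}(t, w₀). -/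

import Mathlib

open Topology Filter

noncomputable section

/-- The involution `τ (z₁, z′) = (-z₁, z′)` on `ℂ × (Fin d → ℂ)`. -/
def tauMap (d : ℕ) : ℂ × (Fin d → ℂ) → ℂ × (Fin d → ℂ) := fun p => (-p.1, p.2)

/-- Translation of a point: `(z₁, z′) ↦ (z₁ - m, z′ - μ)`. -/
def shiftPt (d : ℕ) (σ : ℤ × (Fin d → ℤ)) (p : ℂ × (Fin d → ℂ)) :
    ℂ × (Fin d → ℂ) :=
  (p.1 - (σ.1 : ℂ), fun i => p.2 i - (σ.2 i : ℂ))

/-- A coefficient family. -/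
abbrev Fam (d : ℕ) := (ℤ × (Fin d → ℤ)) → ℂ × (Fin d → ℂ) → ℂ

/-- The family is finitely supported. -/
def FinSuppFam (d : ℕ) (a : Fam d) : Prop := (Function.support a).Finite

/-- `τ`-invariance of a family: `a_{(-m,μ)} (z₁, z′) = a_{(m,μ)} (-z₁, z′)`. -/
def TauInvFam (d : ℕ) (a : Fam d) : Prop :=
  ∀ (m : ℤ) (μ : Fin d → ℤ) (p : ℂ × (Fin d → ℂ)),
    a (-m, μ) p = a (m, μ) (tauMap d p)

/-- `W` is admissible: open, contains `v = (0, w₀)`, and invariant under `τ`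
and under all integer translations. -/
def Admissible (d : ℕ) (w₀ : Fin d → ℂ) (W : Set (ℂ × (Fin d → ℂ))) : Prop :=
  IsOpen W ∧ ((0 : ℂ), w₀) ∈ W ∧ (∀ p ∈ W, tauMap d p ∈ W) ∧
    ∀ (σ : ℤ × (Fin d → ℤ)), ∀ p ∈ W, shiftPt d σ p ∈ W

/-- Action of a coefficient family on a function:
`(a · F) (z₁, z′) = Σ_{(m,μ)} a_{(m,μ)} (z₁, z′) · F (z₁ - m, z′ - μ)`. -/
def actFam (d : ℕ) (a : Fam d) (F : ℂ × (Fin d → ℂ) → ℂ) :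
    ℂ × (Fin d → ℂ) → ℂ :=
  fun p => ∑ᶠ σ : ℤ × (Fin d → ℤ), a σ p * F (shiftPt d σ p)

section HadamardQuotient

variable {𝕜 E F : Type*} [NontriviallyNormedField 𝕜] [NormedAddCommGroup E] [NormedSpace 𝕜 E]
  [NormedAddCommGroup F] [NormedSpace 𝕜 F]

/-- The power series of the quotient `(f (x + y) - f (x + P y)) / L y`, when `f` has the power
series `p` at `x` and `y - P y = L y • e`. -/
def FormalMultilinearSeries.hadamardQuotient (p : FormalMultilinearSeries 𝕜 E F) (P : E →L[𝕜] E)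
    (e : E) : FormalMultilinearSeries 𝕜 E F := fun n =>
  ∑ k : Fin (n + 1), ((p (n + 1)).compContinuousLinearMap
    (fun i => if i < k then P else ContinuousLinearMap.id 𝕜 E)).curryMid k e

namespace FormalMultilinearSeries

variable (p : FormalMultilinearSeries 𝕜 E F) (P : E →L[𝕜] E) (e : E)

theorem smul_hadamardQuotient_apply {L : E → 𝕜} (hP : ∀ y, y - P y = L y • e) (n : ℕ) (y : E) :
    L y • p.hadamardQuotient P e n (fun _ => y) =
      p (n + 1) (fun _ => y) - p (n + 1) (fun _ => P y) := by
  let T : ℕ → F := fun k => p (n + 1) (fun i => if (i : ℕ) < k then P y else y)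
  have hT : ∀ k : Fin (n + 1), L y • ((p (n + 1)).compContinuousLinearMap
      (fun i => if i < k then P else ContinuousLinearMap.id 𝕜 E)).curryMid k e (fun _ => y) =
        T k - T (k + 1) := by
    intro k
    let m : Fin (n + 1) → E := fun i => if i < k then P y else y
    have h₀ : T k = p (n + 1) (Function.update m k y) := by
      refine congrArg _ (funext fun i => ?_)
      rcases eq_or_ne i k with rfl | hi
      · simp
      · simp [m, Function.update_of_ne hi]
    have h₁ : T (k + 1) = p (n + 1) (Function.update m k (P y)) := by
      refine congrArg _ (funext fun i => ?_)
      rcases eq_or_ne i k with rfl | hi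
      · simp
      · have : (i : ℕ) < k + 1 ↔ i < k := by
          have := Fin.val_ne_of_ne hi
          rw [Fin.lt_def]; omega
        simp [m, Function.update_of_ne hi, this]
    rw [h₀, h₁, ← ContinuousMultilinearMap.map_update_sub, hP,
      ContinuousMultilinearMap.map_update_smul, ContinuousMultilinearMap.curryMid_apply,
      ContinuousMultilinearMap.compContinuousLinearMap_apply]
    congr 2; ext i
    rcases eq_or_ne i k with rfl | hi
    · simp
    · obtain ⟨j, rfl⟩ := Fin.exists_succAbove_eq hi
      by_cases h : k.succAbove j < k <;> simp [m, h]
  have hsum : ∑ k : Fin (n + 1), (T k - T (k + 1)) = T 0 - T (n + 1) := by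
    rw [← Finset.sum_range_sub', Finset.sum_range]
  simp only [hadamardQuotient, _root_.sum_apply, Finset.smul_sum, hT, hsum]
  have hlast : T (n + 1) = p (n + 1) (fun _ => P y) :=
    congrArg _ (funext fun i => if_pos i.isLt)
  rw [hlast]
  simp [T]

theorem norm_hadamardQuotient_le (n : ℕ) :
    ‖p.hadamardQuotient P e n‖ ≤ (n + 1) * (‖p (n + 1)‖ * (max 1 ‖P‖) ^ (n + 1) * ‖e‖) := by
  refine (norm_sum_le _ _).trans ((Finset.sum_le_card_nsmul _ _
    (‖p (n + 1)‖ * (max 1 ‖P‖) ^ (n + 1) * ‖e‖) fun k _ => ?_).trans_eq (by simp))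
  refine (ContinuousLinearMap.le_opNorm _ _).trans ?_
  rw [ContinuousMultilinearMap.norm_curryMid]
  gcongr
  refine (ContinuousMultilinearMap.norm_compContinuousLinearMap_le _ _).trans ?_
  gcongr
  refine (Finset.prod_le_prod (g := fun _ => max 1 ‖P‖) (fun _ _ => norm_nonneg _)
    fun i _ => ?_).trans_eq (by simp)
  split_ifs
  · exact le_max_right _ _
  · exact ContinuousLinearMap.norm_id_le.trans (le_max_left _ _)

theorem radius_hadamardQuotient_pos (hp : 0 < p.radius) :
    0 < (p.hadamardQuotient P e).radius := by
  obtain ⟨C, r, hC, hr, hle⟩ := p.le_mul_pow_of_radius_pos hp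
  set M := max 1 ‖P‖
  have hM : 0 < M := lt_max_of_lt_left one_pos
  let ρ : NNReal := ⟨(2 * (r * M))⁻¹, by positivity⟩
  have hρ : 0 < ρ := by
    rw [← NNReal.coe_pos]; change (0 : ℝ) < (2 * (r * M))⁻¹; positivity
  refine lt_of_lt_of_le (ENNReal.coe_pos.2 hρ)
    (le_radius_of_bound _ (C * ‖e‖ * (2 * (r * M))) fun n => ?_)
  have hn : (n : ℝ) + 1 ≤ 2 ^ (n + 1) := by
    exact_mod_cast (Nat.lt_two_pow_self (n := n + 1)).le
  calc ‖p.hadamardQuotient P e n‖ * (ρ : ℝ) ^ n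
      ≤ ((n + 1) * (‖p (n + 1)‖ * M ^ (n + 1) * ‖e‖)) * (ρ : ℝ) ^ n := by
        gcongr; exact p.norm_hadamardQuotient_le P e n
    _ ≤ (2 ^ (n + 1) * (C * r ^ (n + 1) * M ^ (n + 1) * ‖e‖)) * (ρ : ℝ) ^ n := by
        gcongr; exact hle _
    _ = C * ‖e‖ * (2 * (r * M)) * ((2 * (r * M)) * ρ) ^ n := by ring
    _ = C * ‖e‖ * (2 * (r * M)) := by
        have : 2 * (r * M) * (ρ : ℝ) = 1 := mul_inv_cancel₀ (by positivity)
        rw [this, one_pow, mul_one]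

end FormalMultilinearSeries

/-- Hadamard's lemma for analytic functions: if `y - P y = L y • e`, then the increment
`f (x + y) - f (x + P y)` is divisible by `L y` among analytic functions. -/
theorem AnalyticAt.exists_sub_eq_smul [CompleteSpace F] {f : E → F} {x : E}
    (hf : AnalyticAt 𝕜 f x) (P : E →L[𝕜] E) {e : E} {L : E → 𝕜}
    (hP : ∀ y, y - P y = L y • e) :
    ∃ G : E → F, AnalyticAt 𝕜 G x ∧
      ∀ᶠ z in 𝓝 x, f z - f (x + P (z - x)) = L (z - x) • G z := by
  obtain ⟨p, r, hp⟩ := hf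
  set q := p.hadamardQuotient P e
  have hq := q.hasFPowerSeriesOnBall
    (p.radius_hadamardQuotient_pos P e (hp.r_pos.trans_le hp.r_le))
  have hsub : Tendsto (fun z => z - x) (𝓝 x) (𝓝 0) := by
    have : ContinuousAt (fun z => z - x) x := by fun_prop
    simpa [ContinuousAt] using this
  have hPsub : Tendsto (fun z => P (z - x)) (𝓝 x) (𝓝 0) := by
    have := (P.continuous.tendsto 0).comp hsub
    rwa [map_zero] at this
  refine ⟨fun z => q.sum (z - x), ?_, ?_⟩
  · refine AnalyticAt.fun_comp (g := q.sum) ?_ (by fun_prop)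
    simpa using hq.analyticAt
  · filter_upwards [hsub (Metric.eball_mem_nhds 0 hp.r_pos),
      hPsub (Metric.eball_mem_nhds 0 hp.r_pos),
      hsub (Metric.eball_mem_nhds 0 hq.r_pos)] with z h₁ h₂ h₃
    have hd := (hp.hasSum h₁).sub (hp.hasSum h₂)
    have hs := (hq.hasSum h₃).const_smul (L (z - x))
    rw [← hasSum_nat_add_iff' 1] at hd
    simp only [q, p.smul_hadamardQuotient_apply P e hP, zero_add] at hs
    have h0 : (fun _ : Fin 0 => z - x) = fun _ => P (z - x) := Subsingleton.elim _ _
    have := hd.unique hs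
    simpa [h0] using this

end HadamardQuotient

/-- An analytic function on `ℂ × E` which vanishes at a point together with the hyperplane
`z₁ = 0` through it is, near that point, `z₁` times an analytic function. -/
theorem AnalyticAt.exists_eq_fst_mul {E : Type*} [NormedAddCommGroup E] [NormedSpace ℂ E]
    {f : ℂ × E → ℂ} {w : E} (hf : AnalyticAt ℂ f (0, w))
    (h0 : ∀ᶠ z in 𝓝 ((0 : ℂ), w), f (0, z.2) = 0) :
    ∃ G : ℂ × E → ℂ, AnalyticAt ℂ G (0, w) ∧ (∀ᶠ z in 𝓝 ((0 : ℂ), w), f z = z.1 * G z) ∧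
      G (0, w) = deriv (fun t => f (t, w)) 0 := by
  obtain ⟨G, hG, h⟩ := hf.exists_sub_eq_smul (e := ((1 : ℂ), (0 : E))) (L := Prod.fst)
    ((ContinuousLinearMap.inr ℂ ℂ E).comp (ContinuousLinearMap.snd ℂ ℂ E))
    (fun y => by ext <;> simp)
  have hfG : ∀ᶠ z in 𝓝 ((0 : ℂ), w), f z = z.1 * G z := by
    filter_upwards [h, h0] with z hz hz0
    simpa [hz0] using hz
  refine ⟨G, hG, hfG, ?_⟩
  have hline : AnalyticAt ℂ (fun t : ℂ => (t, w)) 0 := by fun_prop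
  have hGd : DifferentiableAt ℂ (fun t : ℂ => G (t, w)) 0 :=
    hG.along_fst.differentiableAt
  have heq : (fun t => f (t, w)) =ᶠ[𝓝 0] fun t => t * G (t, w) :=
    hline.continuousAt.tendsto.eventually hfG
  rw [heq.deriv_eq, deriv_fun_mul differentiableAt_fun_id hGd]
  simp

theorem Set.EqOn.of_fst_ne_zero {E : Type*} [TopologicalSpace E] {W : Set (ℂ × E)}
    (hW : IsOpen W) {f g : ℂ × E → ℂ} (hf : ContinuousOn f W) (hg : ContinuousOn g W)
    (h : ∀ p ∈ W, p.1 ≠ 0 → f p = g p) : Set.EqOn f g W := by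
  have hd : Dense (Prod.fst ⁻¹' {(0 : ℂ)}ᶜ : Set (ℂ × E)) :=
    (dense_compl_singleton (0 : ℂ)).preimage isOpenMap_fst
  exact Set.EqOn.of_subset_closure (fun p hp => h p hp.1 hp.2) hf hg Set.inter_subset_left
    (hd.open_subset_closure_inter hW)

theorem continuous_tauMap (d : ℕ) : Continuous (tauMap d) := by
  unfold tauMap; fun_prop

theorem analyticAt_shiftPt (d : ℕ) (σ : ℤ × (Fin d → ℤ)) (p : ℂ × (Fin d → ℂ)) :
    AnalyticAt ℂ (shiftPt d σ) p := by
  change AnalyticAt ℂ (fun p : ℂ × (Fin d → ℂ) => p - ((σ.1 : ℂ), fun i => (σ.2 i : ℂ))) p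
  fun_prop

theorem shiftPt_tauMap (d : ℕ) (σ : ℤ × (Fin d → ℤ)) (p : ℂ × (Fin d → ℂ)) :
    shiftPt d σ (tauMap d p) = tauMap d (shiftPt d (-σ.1, σ.2) p) := by
  ext <;> simp [shiftPt, tauMap]; ring

/-- **Proposition 3.3 of the paper (formula (4)).**  Let `a` be a finitely
supported `τ`-invariant coefficient family, at most `1`-singular on an
admissible `W`, with analytic witnesses `g σ` (so `a σ = g σ / z₁` off
`z₁ = 0`).  For every `F` analytic on `W` with `F ∘ τ = F` on `W`, the
function `a · F` extends analytically at `v = (0, w₀)`, and the value of the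
extension at `v` is
`Σ_σ [ g σ (v) · ∂₁F (-m, w₀ - μ) + ∂₁(g σ) (v) · ½ (F (-m, w₀ - μ) + F (m, w₀ - μ)) ]`. -/
theorem ev_v_formula (d : ℕ) (w₀ : Fin d → ℂ)
    (W : Set (ℂ × (Fin d → ℂ))) (hW : Admissible d w₀ W)
    (a : Fam d) (hfin : FinSuppFam d a) (htau : TauInvFam d a)
    (g : (ℤ × (Fin d → ℤ)) → ℂ × (Fin d → ℂ) → ℂ)
    (hg : ∀ σ : ℤ × (Fin d → ℤ), AnalyticOnNhd ℂ (g σ) W)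
    (hag : ∀ σ : ℤ × (Fin d → ℤ), ∀ p ∈ W, p.1 ≠ 0 → a σ p = g σ p / p.1)
    (F : ℂ × (Fin d → ℂ) → ℂ) (hF : AnalyticOnNhd ℂ F W)
    (hFtau : ∀ p ∈ W, F (tauMap d p) = F p) :
    ∃ G : ℂ × (Fin d → ℂ) → ℂ, AnalyticAt ℂ G ((0 : ℂ), w₀) ∧
      (∀ᶠ p : ℂ × (Fin d → ℂ) in 𝓝 ((0 : ℂ), w₀),
        p.1 ≠ 0 → actFam d a F p = G p) ∧
      G ((0 : ℂ), w₀) = ∑ᶠ σ : ℤ × (Fin d → ℤ),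
        (g σ ((0 : ℂ), w₀) *
            deriv (fun t : ℂ => F (t, fun i => w₀ i - (σ.2 i : ℂ))) (-(σ.1 : ℂ)) +
          deriv (fun t : ℂ => g σ (t, w₀)) 0 *
            ((1 / 2) * (F (-(σ.1 : ℂ), fun i => w₀ i - (σ.2 i : ℂ)) +
              F ((σ.1 : ℂ), fun i => w₀ i - (σ.2 i : ℂ))))) := by
  replace hfin : (Function.support a).Finite := hfin
  obtain ⟨hWo, hv, hWτ, hWs⟩ := hW
  set v : ℂ × (Fin d → ℂ) := (0, w₀)
  have hg0 : ∀ σ, a σ = 0 → ∀ p ∈ W, g σ p = 0 := fun σ hσ =>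
    Set.EqOn.of_fst_ne_zero hWo (hg σ).continuousOn continuousOn_const fun p hp hp0 => by
      have := hag σ p hp hp0
      rw [hσ] at this
      simpa [hp0, eq_comm] using this
  have hgτ : ∀ (m : ℤ) (μ : Fin d → ℤ), ∀ p ∈ W, g (m, μ) (tauMap d p) = -g (-m, μ) p :=
    fun m μ => Set.EqOn.of_fst_ne_zero hWo
      ((hg _).continuousOn.comp (continuous_tauMap d).continuousOn hWτ) (hg _).continuousOn.neg
      fun p hp hp0 => by
        have hp0' : (tauMap d p).1 ≠ 0 := neg_ne_zero.2 hp0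
        have h := htau m μ p
        rw [hag _ p hp hp0, hag _ _ (hWτ p hp) hp0'] at h
        change _ = _ / -p.1 at h
        field_simp at h
        simpa [eq_comm, neg_eq_iff_eq_neg] using h
  let N : ℂ × (Fin d → ℂ) → ℂ := fun p => ∑ σ ∈ hfin.toFinset, g σ p * F (shiftPt d σ p)
  have hNsum : ∀ p ∈ W, N p = ∑ᶠ σ, g σ p * F (shiftPt d σ p) := fun p hp =>
    (finsum_eq_sum_of_support_subset _ fun σ hσ => by
      simp only [Set.Finite.coe_toFinset, Function.mem_support]
      exact fun h => hσ (by simp [hg0 σ h p hp])).symm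
  have hNodd : ∀ p ∈ W, N (tauMap d p) = -N p := fun p hp => by
    let ε : ℤ × (Fin d → ℤ) ≃ ℤ × (Fin d → ℤ) := (Equiv.neg ℤ).prodCongr (Equiv.refl _)
    rw [hNsum _ (hWτ p hp), hNsum p hp, ← finsum_neg_distrib, ← finsum_comp_equiv ε]
    refine finsum_congr fun σ => ?_
    change g (-σ.1, σ.2) _ * F (shiftPt d (-σ.1, σ.2) _) = _
    rw [hgτ _ _ p hp, shiftPt_tauMap, hFtau _ (hWs _ p hp)]
    simp
  have hterm : ∀ σ, AnalyticAt ℂ (fun p => F (shiftPt d σ p)) v := fun σ =>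
    AnalyticAt.fun_comp (hF _ (hWs σ v hv)) (analyticAt_shiftPt d σ v)
  have hNan : AnalyticAt ℂ N v :=
    Finset.analyticAt_fun_sum _ fun σ _ => (hg σ v hv).mul (hterm σ)
  have hN0 : ∀ᶠ z in 𝓝 v, N (0, z.2) = 0 := by
    have hc : ContinuousAt (fun z : ℂ × (Fin d → ℂ) => ((0 : ℂ), z.2)) v := by fun_prop
    filter_upwards [hc.preimage_mem_nhds (hWo.mem_nhds hv)] with z hz
    have h := hNodd _ hz
    simp only [tauMap, neg_zero] at h
    exact self_eq_neg.1 h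
  obtain ⟨G, hG, hNG, hGv⟩ := hNan.exists_eq_fst_mul hN0
  refine ⟨G, hG, ?_, ?_⟩
  · filter_upwards [hNG, hWo.mem_nhds hv] with p hp hpW hp0
    rw [← mul_right_inj' hp0, ← hp, hNsum p hpW, actFam, ← smul_eq_mul, smul_finsum]
    refine finsum_congr fun σ => ?_
    rw [hag σ p hpW hp0, smul_eq_mul]
    field_simp
  · have hline : AnalyticAt ℂ (fun t : ℂ => (t, w₀)) 0 := by fun_prop
    have hgl : ∀ σ, DifferentiableAt ℂ (fun t : ℂ => g σ (t, w₀)) 0 := fun σ =>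
      (hg σ v hv).along_fst.differentiableAt
    have hFl : ∀ σ, DifferentiableAt ℂ (fun t : ℂ => F (shiftPt d σ (t, w₀))) 0 := fun σ =>
      (hterm σ).along_fst.differentiableAt
    rw [finsum_eq_sum_of_support_subset (s := hfin.toFinset), hGv,
      deriv_fun_sum fun σ _ => (hgl σ).fun_mul (hFl σ)]
    · refine Finset.sum_congr rfl fun σ _ => ?_
      have hFsymm := hFtau _ (hWs σ v hv)
      have hdF : deriv (fun t : ℂ => F (shiftPt d σ (t, w₀))) 0 =
          deriv (fun t : ℂ => F (t, fun i => w₀ i - (σ.2 i : ℂ))) (-(σ.1 : ℂ)) := by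
        simpa [shiftPt] using
          deriv_comp_sub_const (fun t : ℂ => F (t, fun i => w₀ i - (σ.2 i : ℂ))) (σ.1 : ℂ) 0
      rw [deriv_fun_mul (hgl σ) (hFl σ), hdF]
      simp only [shiftPt, tauMap, v, zero_sub, neg_neg] at hFsymm ⊢
      rw [hFsymm]
      ring
    · intro σ hσ
      simp only [Set.Finite.coe_toFinset, Function.mem_support]
      refine fun h => hσ ?_
      have hz : (fun t : ℂ => g σ (t, w₀)) =ᶠ[𝓝 0] fun _ => 0 := by
        filter_upwards [hline.continuousAt.preimage_mem_nhds (hWo.mem_nhds hv)] with t ht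
        exact hg0 σ h _ ht
      simp [hz.deriv_eq, hg0 σ h v hv]

end
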